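/- Under the convexity and qualification assumptions, the system (MFG) admits at least one solution (m,π,u,γ,P). -/

import Mathlib

noncomputable section
open Finset Filter Topology Bornology
open scoped Classical Pointwise

/-- Fenchel conjugate of a function on a finite coordinate space. -/
def conjFn {d : Type*} [Fintype d] (g : (d → ℝ) → EReal) (y : d → ℝ) : EReal :=
  ⨆ x : d → ℝ, (↑(∑ i, x i * y i) : EReal) - g x

/-- Fenchel conjugate, scalar case. -/
def conjR (g : ℝ → EReal) (y : ℝ) : EReal :=
  ⨆ x : ℝ, (↑(x * y) : EReal) - g x

/-- Subdifferential (empty where `g = ⊤`). -/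
def subdiffFn {d : Type*} [Fintype d] (g : (d → ℝ) → EReal) (x : d → ℝ) : Set (d → ℝ) :=
  {p | g x ≠ ⊤ ∧ ∀ x', g x + (↑(∑ i, p i * (x' i - x i)) : EReal) ≤ g x'}

def subdiffR (g : ℝ → EReal) (x : ℝ) : Set ℝ :=
  {p | g x ≠ ⊤ ∧ ∀ x', g x + (↑(p * (x' - x)) : EReal) ≤ g x'}

def EProper {E : Type*} (g : E → EReal) : Prop := (∃ x, g x ≠ ⊤) ∧ ∀ x, g x ≠ ⊥

def EConvexOn {E : Type*} [AddCommMonoid E] [SMul ℝ E] (g : E → EReal) : Prop :=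
  ∀ x y : E, ∀ a b : ℝ, 0 ≤ a → 0 ≤ b → a + b = 1 →
    g (a • x + b • y) ≤ (a : EReal) * g x + (b : EReal) * g y

def EStrictConvexOn {E : Type*} [AddCommMonoid E] [SMul ℝ E] (g : E → EReal) : Prop :=
  ∀ x y : E, x ≠ y → g x ≠ ⊤ → g y ≠ ⊤ → ∀ a b : ℝ, 0 < a → 0 < b → a + b = 1 →
    g (a • x + b • y) < (a : EReal) * g x + (b : EReal) * g y

/-- Perspective function. -/
def persp {d : Type*} [Fintype d] (h : (d → ℝ) → EReal) (θ : ℝ) (x : d → ℝ) : EReal :=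
  if 0 < θ then (θ : EReal) * h (θ⁻¹ • x)
  else if θ = 0 ∧ x = 0 then 0 else ⊤

/-- The simplex `Δ(S)`. -/
def simplex (n : ℕ) : Set (Fin n → ℝ) :=
  {ρ | (∀ y, ρ y ∈ Set.Icc (0 : ℝ) 1) ∧ ∑ y, ρ y = 1}

abbrev Msp (T n : ℕ) := Fin (T + 1) → Fin n → ℝ
abbrev Wsp (T n : ℕ) := Fin T → Fin n → Fin n → ℝ
abbrev Psp (T : ℕ) := Fin T → ℝ
abbrev Csp (T n : ℕ) := Msp T n × Wsp T n × Msp T n × Psp T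
abbrev Ksp (T n : ℕ) := Msp T n × Msp T n × Psp T
abbrev LSp (T n : ℕ) := Fin T → Fin n → (Fin n → ℝ) → EReal
abbrev FSp (T n : ℕ) := Fin (T + 1) → (Fin n → ℝ) → EReal
abbrev PhiSp (T : ℕ) := Fin T → ℝ → EReal
abbrev ASp (T n : ℕ) := Fin T → Fin n → Fin n → ℝ

variable {T n : ℕ}

def opA (α : ASp T n) (w : Wsp T n) (t : Fin T) : ℝ := ∑ x, ∑ y, w t x y * α t x y

def opS (w : Wsp T n) (s : Fin (T + 1)) (x : Fin n) : ℝ :=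
  if h : (s : ℕ) = 0 then 0
  else ∑ y, w ⟨(s : ℕ) - 1, by have := s.isLt; omega⟩ y x

def mbar0 (m0 : Fin n → ℝ) (s : Fin (T + 1)) (x : Fin n) : ℝ := if s = 0 then m0 x else 0

def Qcpl (α : ASp T n) (m : Msp T n) (π : Wsp T n) (t : Fin T) : ℝ :=
  ∑ x, ∑ y, m t.castSucc x * π t x y * α t x y

def IsKol (m0 : Fin n → ℝ) (π : Wsp T n) (m : Msp T n) : Prop :=
  (∀ x, m 0 x = m0 x) ∧
    ∀ (t : Fin T) (x : Fin n), m t.succ x = ∑ y, m t.castSucc y * π t y x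

def InDelta (π : Wsp T n) : Prop := ∀ t x, π t x ∈ simplex n

def ConvAssumption (ℓ : LSp T n) (F : FSp T n) (φ : PhiSp T) : Prop :=
  (∀ t x, EProper (ℓ t x) ∧ EConvexOn (ℓ t x) ∧ LowerSemicontinuous (ℓ t x) ∧
    ∀ ρ, ℓ t x ρ ≠ ⊤ → ρ ∈ simplex n) ∧
  (∀ s, EProper (F s) ∧ EConvexOn (F s) ∧ LowerSemicontinuous (F s)) ∧
  (∀ t, EProper (φ t) ∧ EConvexOn (φ t) ∧ LowerSemicontinuous (φ t))

def Jpot (ℓ : LSp T n) (F : FSp T n) (φ : PhiSp T) (α : ASp T n)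
    (m : Msp T n) (π : Wsp T n) : EReal :=
  (∑ t, ∑ x, (↑(m t.castSucc x) : EReal) * ℓ t x (π t x)) +
    (∑ t, φ t (Qcpl α m π t)) + ∑ s, F s (m s)

def Jtil (ℓ : LSp T n) (F : FSp T n) (φ : PhiSp T) (α : ASp T n)
    (m : Msp T n) (w : Wsp T n) : EReal :=
  (∑ t, ∑ x, persp (ℓ t x) (m t.castSucc x) (w t x)) +
    (∑ t, φ t (opA α w t)) + ∑ s, F s (m s)

def FeasP (m0 : Fin n → ℝ) (p : Msp T n × Wsp T n) : Prop := InDelta p.2 ∧ IsKol m0 p.2 p.1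

def FeasPt (m0 : Fin n → ℝ) (p : Msp T n × Wsp T n) : Prop :=
  ∀ s x, opS p.2 s x - p.1 s x + mbar0 m0 s x = 0

def valP (ℓ : LSp T n) (F : FSp T n) (φ : PhiSp T) (α : ASp T n) (m0 : Fin n → ℝ) : EReal :=
  ⨅ p ∈ {p : Msp T n × Wsp T n | FeasP m0 p}, Jpot ℓ F φ α p.1 p.2

def valPt (ℓ : LSp T n) (F : FSp T n) (φ : PhiSp T) (α : ASp T n) (m0 : Fin n → ℝ) : EReal :=
  ⨅ p ∈ {p : Msp T n × Wsp T n | FeasPt m0 p}, Jtil ℓ F φ α p.1 p.2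

def IsSolP (ℓ : LSp T n) (F : FSp T n) (φ : PhiSp T) (α : ASp T n) (m0 : Fin n → ℝ)
    (p : Msp T n × Wsp T n) : Prop :=
  FeasP m0 p ∧ ∀ q, FeasP m0 q → Jpot ℓ F φ α p.1 p.2 ≤ Jpot ℓ F φ α q.1 q.2

def IsSolPt (ℓ : LSp T n) (F : FSp T n) (φ : PhiSp T) (α : ASp T n) (m0 : Fin n → ℝ)
    (p : Msp T n × Wsp T n) : Prop :=
  FeasPt m0 p ∧ ∀ q, FeasPt m0 q → Jtil ℓ F φ α p.1 p.2 ≤ Jtil ℓ F φ α q.1 q.2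

def dpCost (ℓ : LSp T n) (α : ASp T n) (u : Msp T n) (P : Psp T)
    (t : Fin T) (x : Fin n) : EReal :=
  conjFn (ℓ t x) (fun y => -(α t x y * P t + u t.succ y))

def FeasD (ℓ : LSp T n) (α : ASp T n) (k : Ksp T n) : Prop :=
  (∀ t x, (↑(k.1 t.castSucc x) : EReal) + dpCost ℓ α k.1 k.2.2 t x ≤ ↑(k.2.1 t.castSucc x)) ∧
  ∀ x, k.1 (Fin.last T) x = k.2.1 (Fin.last T) x

def Dobj (F : FSp T n) (φ : PhiSp T) (m0 : Fin n → ℝ) (k : Ksp T n) : EReal :=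
  (↑(∑ x, m0 x * k.1 0 x) : EReal) - (∑ t, conjR (φ t) (k.2.2 t)) -
    ∑ s, conjFn (F s) (k.2.1 s)

def valD (ℓ : LSp T n) (F : FSp T n) (φ : PhiSp T) (α : ASp T n) (m0 : Fin n → ℝ) : EReal :=
  ⨆ k ∈ {k : Ksp T n | FeasD ℓ α k}, Dobj F φ m0 k

def IsSolD (ℓ : LSp T n) (F : FSp T n) (φ : PhiSp T) (α : ASp T n) (m0 : Fin n → ℝ)
    (k : Ksp T n) : Prop :=
  FeasD ℓ α k ∧ ∀ k', FeasD ℓ α k' → Dobj F φ m0 k' ≤ Dobj F φ m0 k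

/-- `IsDP ℓ α γ P u` : `u = U[γ,P]`, i.e. `u` solves the dynamic programming equation. -/
def IsDP (ℓ : LSp T n) (α : ASp T n) (γ : Msp T n) (P : Psp T) (u : Msp T n) : Prop :=
  (∀ (t : Fin T) (x : Fin n),
    (↑(u t.castSucc x) : EReal) + dpCost ℓ α u P t x = ↑(γ t.castSucc x)) ∧
  ∀ x, u (Fin.last T) x = γ (Fin.last T) x

def valDt (ℓ : LSp T n) (F : FSp T n) (φ : PhiSp T) (α : ASp T n) (m0 : Fin n → ℝ) : EReal :=
  ⨆ k ∈ {k : Ksp T n | IsDP ℓ α k.2.1 k.2.2 k.1}, Dobj F φ m0 k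

def IsSolDt (ℓ : LSp T n) (F : FSp T n) (φ : PhiSp T) (α : ASp T n) (m0 : Fin n → ℝ)
    (γ : Msp T n) (P : Psp T) (u : Msp T n) : Prop :=
  IsDP ℓ α γ P u ∧
    ∀ γ' P' u', IsDP ℓ α γ' P' u' → Dobj F φ m0 (u', γ', P') ≤ Dobj F φ m0 (u, γ, P)

def IsKolPert (m0 : Fin n → ℝ) (ε1 : Msp T n) (π : Wsp T n) (m1 : Msp T n) : Prop :=
  (∀ x, m1 0 x = mbar0 m0 (0 : Fin (T + 1)) x + ε1 0 x) ∧
  ∀ (t : Fin T) (x : Fin n), m1 t.succ x = (∑ y, m1 t.castSucc y * π t y x) - ε1 t.succ x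

def qnorm (ε1 ε2 : Msp T n) (ε3 : Psp T) : ℝ :=
  Real.sqrt ((∑ s, ∑ x, ε1 s x ^ 2) + (∑ s, ∑ x, ε2 s x ^ 2) + ∑ t, ε3 t ^ 2)

def Qualif (ℓ : LSp T n) (F : FSp T n) (φ : PhiSp T) (α : ASp T n) (m0 : Fin n → ℝ) : Prop :=
  ∃ α0 : ℝ, 0 < α0 ∧ ∀ (ε1 ε2 : Msp T n) (ε3 : Psp T), qnorm ε1 ε2 ε3 ≤ α0 →
    ∃ π : Wsp T n, (∀ t x, ℓ t x (π t x) ≠ ⊤) ∧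
      ∃ m1 : Msp T n, IsKolPert m0 ε1 π m1 ∧ (∀ s x, 0 ≤ m1 s x) ∧
        (∀ s, F s (fun x => m1 s x + ε2 s x) ≠ ⊤) ∧
        ∀ t, φ t (Qcpl α m1 π t + ε3 t) ≠ ⊤

def Fobj (ℓ : LSp T n) (F : FSp T n) (φ : PhiSp T) (c : Csp T n) : EReal :=
  (∑ t, ∑ x, persp (ℓ t x) (c.1 t.castSucc x) (c.2.1 t x)) +
    (∑ t, φ t (c.2.2.2 t)) + ∑ s, F s (c.2.2.1 s)

def Gobj (m0 : Fin n → ℝ) (k : Ksp T n) : EReal :=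
  if (∀ s x, k.1 s x = -(mbar0 m0 s x)) ∧ k.2.1 = 0 ∧ k.2.2 = 0 then 0 else ⊤

def Aop (α : ASp T n) (c : Csp T n) : Ksp T n :=
  (fun s x => opS c.2.1 s x - c.1 s x,
   fun s x => c.1 s x - c.2.2.1 s x,
   fun t => opA α c.2.1 t - c.2.2.2 t)

def AstarOp (α : ASp T n) (k : Ksp T n) : Csp T n :=
  (fun s x => k.2.1 s x - k.1 s x,
   fun t x y => α t x y * k.2.2 t + k.1 t.succ y,
   fun s x => -k.2.1 s x,
   fun t => -k.2.2 t)

def cpair (c c' : Csp T n) : ℝ :=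
  (∑ s, ∑ x, c.1 s x * c'.1 s x) + (∑ t, ∑ x, ∑ y, c.2.1 t x y * c'.2.1 t x y) +
    (∑ s, ∑ x, c.2.2.1 s x * c'.2.2.1 s x) + ∑ t, c.2.2.2 t * c'.2.2.2 t

def kpair (k k' : Ksp T n) : ℝ :=
  (∑ s, ∑ x, k.1 s x * k'.1 s x) + (∑ s, ∑ x, k.2.1 s x * k'.2.1 s x) +
    ∑ t, k.2.2 t * k'.2.2 t

def FobjStar (ℓ : LSp T n) (F : FSp T n) (φ : PhiSp T) (c' : Csp T n) : EReal :=
  ⨆ c : Csp T n, (↑(cpair c c') : EReal) - Fobj ℓ F φ c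

def GobjStar (m0 : Fin n → ℝ) (k : Ksp T n) : EReal := ↑(-(∑ x, m0 x * k.1 0 x))

def PfrakObj (ℓ : LSp T n) (F : FSp T n) (φ : PhiSp T) (α : ASp T n) (m0 : Fin n → ℝ)
    (c : Csp T n) : EReal := Fobj ℓ F φ c + Gobj m0 (Aop α c)

def DfrakObj (ℓ : LSp T n) (F : FSp T n) (φ : PhiSp T) (α : ASp T n) (m0 : Fin n → ℝ)
    (k : Ksp T n) : EReal := FobjStar ℓ F φ (-AstarOp α k) + GobjStar m0 k

def IsSolPfrak (ℓ : LSp T n) (F : FSp T n) (φ : PhiSp T) (α : ASp T n) (m0 : Fin n → ℝ)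
    (c : Csp T n) : Prop := ∀ c', PfrakObj ℓ F φ α m0 c ≤ PfrakObj ℓ F φ α m0 c'

def IsSolDfrak (ℓ : LSp T n) (F : FSp T n) (φ : PhiSp T) (α : ASp T n) (m0 : Fin n → ℝ)
    (k : Ksp T n) : Prop := ∀ k', DfrakObj ℓ F φ α m0 k ≤ DfrakObj ℓ F φ α m0 k'

def MFGi (ℓ : LSp T n) (α : ASp T n) (γ : Msp T n) (P : Psp T) (u : Msp T n) : Prop :=
  (∀ (t : Fin T) (x : Fin n), (↑(u t.castSucc x) : EReal) =
      ⨅ ρ ∈ simplex n,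
        ℓ t x ρ + ↑(γ t.castSucc x) + ↑(∑ y, ρ y * (α t x y * P t + u t.succ y))) ∧
  ∀ x, u (Fin.last T) x = γ (Fin.last T) x

def MFGii (ℓ : LSp T n) (α : ASp T n) (π : Wsp T n) (γ : Msp T n) (P : Psp T)
    (u : Msp T n) : Prop :=
  ∀ (t : Fin T) (x : Fin n),
    ℓ t x (π t x) + ↑(γ t.castSucc x) + ↑(∑ y, π t x y * (α t x y * P t + u t.succ y)) =
      (↑(u t.castSucc x) : EReal)

def IsMFGSol (ℓ : LSp T n) (F : FSp T n) (φ : PhiSp T) (α : ASp T n) (m0 : Fin n → ℝ)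
    (m : Msp T n) (π : Wsp T n) (u : Msp T n) (γ : Msp T n) (P : Psp T) : Prop :=
  InDelta π ∧ MFGi ℓ α γ P u ∧ MFGii ℓ α π γ P u ∧ IsKol m0 π m ∧
    (∀ s, γ s ∈ subdiffFn (F s) (m s)) ∧ ∀ t, P t ∈ subdiffR (φ t) (Qcpl α m π t)


/-- Lagrange multipliers for a convex program: `B` is the constraint set, `A` the affine constraint
map, `f` the affine objective. -/
theorem exists_multiplier {X E : Type*} [AddCommGroup X] [Module ℝ X] [AddCommGroup E]
    [Module ℝ E] {B : Set X} (hB : Convex ℝ B) (A : X → E) (f : X → ℝ)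
    (hA : ∀ x y, ∀ a b : ℝ, a + b = 1 → A (a • x + b • y) = a • A x + b • A y)
    (hf : ∀ x y, ∀ a b : ℝ, a + b = 1 → f (a • x + b • y) = a * f x + b * f y)
    (hint : ∀ e : E, ∃ t : ℝ, 0 < t ∧ ∃ x ∈ B, A x = t • e)
    (hpos : ∀ x ∈ B, A x = 0 → 0 ≤ f x) :
    ∃ k : E →ₗ[ℝ] ℝ, ∀ x ∈ B, 0 ≤ f x + k (A x) := by
  obtain ⟨-, -, x₀, hx₀, -⟩ := hint 0
  let C : PointedCone ℝ (E × ℝ) :=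
    { carrier := {y | ∃ r : ℝ, 0 ≤ r ∧ ∃ x ∈ B, y = r • (A x, f x)}
      zero_mem' := ⟨0, le_rfl, x₀, hx₀, by simp⟩
      add_mem' := by
        rintro _ _ ⟨r, hr, x, hx, rfl⟩ ⟨s, hs, y, hy, rfl⟩
        rcases eq_or_lt_of_le (add_nonneg hr hs) with h | h
        · have h1 : r = 0 := by linarith
          have h2 : s = 0 := by linarith
          exact ⟨0, le_rfl, x₀, hx₀, by simp [h1, h2]⟩
        · have h1 : r / (r + s) + s / (r + s) = 1 := by field_simp
          refine ⟨r + s, h.le, (r / (r + s)) • x + (s / (r + s)) • y,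
            hB hx hy (by positivity) (by positivity) h1, ?_⟩
          rw [hA _ _ _ _ h1, hf _ _ _ _ h1]
          ext
          · simp only [Prod.smul_mk, Prod.mk_add_mk, smul_add, smul_smul]
            rw [mul_div_cancel₀ _ h.ne', mul_div_cancel₀ _ h.ne']
          · simp only [Prod.smul_mk, Prod.mk_add_mk, smul_eq_mul]
            field_simp
      smul_mem' := by
        rintro ⟨c, hc⟩ _ ⟨r, hr, x, hx, rfl⟩
        refine ⟨c * r, mul_nonneg hc hr, x, hx, ?_⟩
        rw [mul_smul]
        rfl }
  have hC : ∀ y, y ∈ C ↔ ∃ r : ℝ, 0 ≤ r ∧ ∃ x ∈ B, y = r • (A x, f x) := fun _ => Iff.rfl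
  let F : (E × ℝ) →ₗ.[ℝ] ℝ :=
    { domain := LinearMap.ker (LinearMap.fst ℝ E ℝ)
      toFun := (LinearMap.snd ℝ E ℝ).comp (Submodule.subtype _) }
  have hF : ∀ y : F.domain, F y = (y : E × ℝ).2 := fun _ => rfl
  have hF1 : ∀ y : F.domain, (y : E × ℝ).1 = 0 := fun y => y.2
  have hnonneg : ∀ y : F.domain, (y : E × ℝ) ∈ C → 0 ≤ F y := by
    intro y hy
    rw [hF]
    obtain ⟨r, hr, x, hx, h⟩ := (hC _).1 hy
    have h1 := hF1 y
    rw [h] at h1 ⊢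
    rcases eq_or_lt_of_le hr with h0 | h0
    · simp [← h0]
    · have h2 : A x = 0 := by simpa [h0.ne'] using h1
      exact mul_nonneg hr (hpos x hx h2)
  have hdense : ∀ y : E × ℝ, ∃ x : F.domain, (x : E × ℝ) + y ∈ C := by
    rintro ⟨e, r⟩
    obtain ⟨t, ht, x, hx, h⟩ := hint e
    refine ⟨⟨(0, t⁻¹ * f x - r), rfl⟩, (hC _).2 ⟨t⁻¹, by positivity, x, hx, ?_⟩⟩
    ext
    · simp [h, smul_smul, ht.ne']
    · simp
  obtain ⟨g, hg, hgC⟩ := riesz_extension C F hnonneg hdense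
  refine ⟨g.comp (LinearMap.inl ℝ E ℝ), fun x hx => ?_⟩
  have h1 := hgC (A x, f x) ((hC _).2 ⟨1, zero_le_one, x, hx, by simp⟩)
  have h2 : g (0, f x) = f x := hg ⟨(0, f x), rfl⟩
  have h3 : (A x, f x) = ((0 : E), f x) + (A x, (0 : ℝ)) := by simp
  rw [h3, map_add, h2] at h1
  simpa using h1

/-- Minimality of a separable sum over a product of sets is minimality of each term. -/
theorem le_of_sum_le_of_pi {ι Y : Type*} [Fintype ι] (C : ι → Set Y) (g : ι → Y → ℝ)
    (y₀ : ι → Y) (hy₀ : ∀ i, y₀ i ∈ C i)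
    (h : ∀ y : ι → Y, (∀ i, y i ∈ C i) → ∑ i, g i (y₀ i) ≤ ∑ i, g i (y i))
    (i : ι) (z : Y) (hz : z ∈ C i) : g i (y₀ i) ≤ g i z := by
  have h1 := h (Function.update y₀ i z) (by
    intro j
    by_cases hj : j = i
    · subst hj; simpa using hz
    · simpa [hj] using hy₀ j)
  rw [← Finset.add_sum_erase _ _ (Finset.mem_univ i),
    ← Finset.add_sum_erase _ (fun j => g j (Function.update y₀ i z j)) (Finset.mem_univ i),
    Finset.sum_congr rfl (g := fun j => g j (y₀ j))
      (f := fun j => g j (Function.update y₀ i z j))] at h1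
  · rw [Function.update_self] at h1
    linarith
  · intro j hj
    simp [Finset.ne_of_mem_erase hj]

theorem EReal.continuousAt_add_of_ne_bot {a b : EReal} (ha : a ≠ ⊥) (hb : b ≠ ⊥) :
    ContinuousAt (fun p : EReal × EReal => p.1 + p.2) (a, b) :=
  EReal.continuousAt_add (Or.inr hb) (Or.inl ha)

theorem EReal.sum_ne_bot {ι : Type*} (s : Finset ι) (f : ι → EReal) (hf : ∀ i ∈ s, f i ≠ ⊥) :
    ∑ i ∈ s, f i ≠ ⊥ := by
  induction s using Finset.induction_on with
  | empty => simp
  | insert i s hi ih =>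
    rw [Finset.sum_insert hi, Ne, EReal.add_eq_bot_iff, not_or]
    exact ⟨hf i (by simp), ih fun j hj => hf j (by simp [hj])⟩

theorem EReal.ne_top_of_add_ne_top {a b : EReal} (ha : a ≠ ⊥) (hb : b ≠ ⊥) (h : a + b ≠ ⊤) :
    a ≠ ⊤ ∧ b ≠ ⊤ := by
  constructor <;> rintro rfl <;> simp_all

theorem EReal.ne_top_of_sum_ne_top {ι : Type*} (s : Finset ι) (f : ι → EReal)
    (hf : ∀ i ∈ s, f i ≠ ⊥) (h : ∑ i ∈ s, f i ≠ ⊤) (i : ι) (hi : i ∈ s) : f i ≠ ⊤ := by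
  rw [← Finset.add_sum_erase _ _ hi] at h
  exact (EReal.ne_top_of_add_ne_top (hf i hi)
    (EReal.sum_ne_bot _ _ fun j hj => hf j (Finset.mem_of_mem_erase hj)) h).1

theorem EReal.coe_finset_sum {ι : Type*} (s : Finset ι) (f : ι → ℝ) :
    ((∑ i ∈ s, f i : ℝ) : EReal) = ∑ i ∈ s, (f i : EReal) := by
  induction s using Finset.induction_on with
  | empty => simp
  | insert i s hi ih => rw [Finset.sum_insert hi, Finset.sum_insert hi, EReal.coe_add, ih]

theorem EReal.coe_mul_ne_bot {θ : ℝ} (hθ : 0 ≤ θ) {a : EReal} (ha : a ≠ ⊥) :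
    (θ : EReal) * a ≠ ⊥ := by
  induction a with
  | bot => exact absurd rfl ha
  | coe a => exact EReal.coe_ne_bot (θ * a)
  | top =>
    rcases eq_or_lt_of_le hθ with h | h
    · simp [← h]
    · rw [EReal.coe_mul_top_of_pos h]; simp

theorem LowerSemicontinuousOn.ereal_add {X : Type*} [TopologicalSpace X] {s : Set X}
    {f g : X → EReal} (hf : LowerSemicontinuousOn f s) (hg : LowerSemicontinuousOn g s)
    (hf' : ∀ x ∈ s, f x ≠ ⊥) (hg' : ∀ x ∈ s, g x ≠ ⊥) :
    LowerSemicontinuousOn (fun x => f x + g x) s :=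
  hf.add' hg fun x hx => EReal.continuousAt_add_of_ne_bot (hf' x hx) (hg' x hx)

theorem LowerSemicontinuousOn.ereal_sum {X ι : Type*} [TopologicalSpace X] {s : Set X}
    (a : Finset ι) {f : ι → X → EReal} (hf : ∀ i ∈ a, LowerSemicontinuousOn (f i) s)
    (hf' : ∀ i ∈ a, ∀ x ∈ s, f i x ≠ ⊥) :
    LowerSemicontinuousOn (fun x => ∑ i ∈ a, f i x) s := by
  induction a using Finset.induction_on with
  | empty =>
    simp only [Finset.sum_empty]
    exact fun x _ => lowerSemicontinuousWithinAt_const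
  | insert i a hi ih =>
    simp only [Finset.sum_insert hi]
    exact (hf i (by simp)).ereal_add (ih (fun j hj => hf j (by simp [hj]))
      fun j hj => hf' j (by simp [hj])) (hf' i (by simp))
      fun x hx => EReal.sum_ne_bot _ _ fun j hj => hf' j (by simp [hj]) x hx

theorem LowerSemicontinuousOn.ereal_coe_mul {X : Type*} [TopologicalSpace X] {s : Set X}
    {θ : X → ℝ} {f : X → EReal} (hθ : ContinuousOn θ s) (hf : LowerSemicontinuousOn f s)
    (hθ0 : ∀ x ∈ s, 0 ≤ θ x) (hf' : ∀ x ∈ s, f x ≠ ⊥) :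
    LowerSemicontinuousOn (fun x => (θ x : EReal) * f x) s := by
  intro x hx y hy
  obtain ⟨z, hz, hyz⟩ : ∃ z : ℝ, (z : EReal) < f x ∧ y < ((θ x * z : ℝ) : EReal) := by
    rcases eq_or_lt_of_le (hθ0 x hx) with h | h
    · obtain ⟨z, -, hz⟩ := EReal.lt_iff_exists_real_btwn.1 (bot_lt_iff_ne_bot.2 (hf' x hx))
      refine ⟨z, hz, ?_⟩
      simpa [← h] using hy
    · obtain ⟨q, hq, hq'⟩ := EReal.lt_iff_exists_real_btwn.1 hy
      refine ⟨q / θ x, ?_, by rwa [mul_div_cancel₀ _ h.ne']⟩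
      by_contra hcon
      rw [not_lt] at hcon
      have := mul_le_mul_of_nonneg_left hcon (EReal.coe_nonneg.2 h.le)
      rw [← EReal.coe_mul, mul_div_cancel₀ _ h.ne'] at this
      exact absurd hq' (not_lt.2 this)
  have hc : ContinuousWithinAt (fun x' => ((θ x' * z : ℝ) : EReal)) s x :=
    continuous_coe_real_ereal.continuousAt.comp_continuousWithinAt ((hθ x hx).mul_const z)
  filter_upwards [hf x hx z hz, hc.eventually (lt_mem_nhds hyz), self_mem_nhdsWithin]
    with x' h1 h2 h3
  refine h2.trans_le ?_
  rw [EReal.coe_mul]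
  exact mul_le_mul_of_nonneg_left h1.le (EReal.coe_nonneg.2 (hθ0 x' h3))

theorem LowerSemicontinuous.comp_continuousOn {X Y : Type*} [TopologicalSpace X]
    [TopologicalSpace Y] {s : Set X} {f : Y → EReal} {g : X → Y} (hf : LowerSemicontinuous f)
    (hg : ContinuousOn g s) : LowerSemicontinuousOn (fun x => f (g x)) s :=
  fun x hx y hy => (hg x hx).eventually (hf (g x) y hy)

theorem simplex_eq_stdSimplex (n : ℕ) : simplex n = stdSimplex ℝ (Fin n) := by
  ext ρ
  refine ⟨fun h => ⟨fun y => (h.1 y).1, h.2⟩, fun h => ⟨fun y => ⟨h.1 y, ?_⟩, h.2⟩⟩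
  rw [← h.2]
  exact Finset.single_le_sum (fun i _ => h.1 i) (Finset.mem_univ y)

theorem isCompact_simplex (n : ℕ) : IsCompact (simplex n) :=
  simplex_eq_stdSimplex n ▸ isCompact_stdSimplex ℝ (Fin n)

/-- The population flow generated by the policy `π` from `m0`. -/
def kolFlow (m0 : Fin n → ℝ) (π : Wsp T n) : Msp T n :=
  Fin.induction m0 fun t v x => ∑ y, v y * π t y x

theorem isKol_kolFlow (m0 : Fin n → ℝ) (π : Wsp T n) : IsKol m0 π (kolFlow m0 π) :=
  ⟨fun _ => rfl, fun t x => by rw [kolFlow, Fin.induction_succ]; rfl⟩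

theorem IsKol.eq_kolFlow {m0 : Fin n → ℝ} {π : Wsp T n} {m : Msp T n} (h : IsKol m0 π m) :
    m = kolFlow m0 π := by
  funext s
  induction s using Fin.induction with
  | zero => exact funext h.1
  | succ t ih =>
    funext x
    rw [h.2, (isKol_kolFlow m0 π).2, ih]

theorem kolFlow_nonneg {m0 : Fin n → ℝ} (hm0 : ∀ x, 0 ≤ m0 x) {π : Wsp T n} (hπ : InDelta π)
    (s : Fin (T + 1)) (x : Fin n) : 0 ≤ kolFlow m0 π s x := by
  induction s using Fin.induction generalizing x with
  | zero => exact hm0 x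
  | succ t ih =>
    rw [(isKol_kolFlow m0 π).2]
    exact Finset.sum_nonneg fun y _ => mul_nonneg (ih y) ((hπ t y).1 x).1

theorem continuous_kolFlow (m0 : Fin n → ℝ) (s : Fin (T + 1)) (x : Fin n) :
    Continuous fun π : Wsp T n => kolFlow m0 π s x := by
  induction s using Fin.induction generalizing x with
  | zero => exact continuous_const
  | succ t ih =>
    simp only [(isKol_kolFlow m0 _).2]
    exact continuous_finsetSum _ fun y _ => (ih y).mul (by fun_prop)

theorem Jpot_terms_ne_bot {ℓ : LSp T n} {F : FSp T n} {φ : PhiSp T} (α : ASp T n)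
    (hconv : ConvAssumption ℓ F φ) {m : Msp T n} (hm : ∀ s x, 0 ≤ m s x) (π : Wsp T n) :
    (∀ t, ∑ x, (↑(m t.castSucc x) : EReal) * ℓ t x (π t x) ≠ ⊥) ∧
    (∑ t, ∑ x, (↑(m t.castSucc x) : EReal) * ℓ t x (π t x)) ≠ ⊥ ∧
    (∑ t, φ t (Qcpl α m π t)) ≠ ⊥ ∧ (∑ s, F s (m s)) ≠ ⊥ := by
  have h : ∀ t, ∑ x, (↑(m t.castSucc x) : EReal) * ℓ t x (π t x) ≠ ⊥ := fun t =>
    EReal.sum_ne_bot _ _ fun x _ => EReal.coe_mul_ne_bot (hm _ _) ((hconv.1 t x).1.2 _)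
  exact ⟨h, EReal.sum_ne_bot _ _ fun t _ => h t,
    EReal.sum_ne_bot _ _ fun t _ => (hconv.2.2 t).1.2 _,
    EReal.sum_ne_bot _ _ fun s _ => (hconv.2.1 s).1.2 _⟩

theorem lowerSemicontinuousOn_Jpot {ℓ : LSp T n} {F : FSp T n} {φ : PhiSp T} (α : ASp T n)
    (hconv : ConvAssumption ℓ F φ) {m0 : Fin n → ℝ} (hm0 : ∀ x, 0 ≤ m0 x) :
    LowerSemicontinuousOn (fun π => Jpot ℓ F φ α (kolFlow m0 π) π) {π | InDelta π} := by
  have hnn : ∀ π : Wsp T n, InDelta π → ∀ s x, 0 ≤ kolFlow m0 π s x :=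
    fun π hπ => kolFlow_nonneg hm0 hπ
  have hk := fun s x => continuous_kolFlow (T := T) m0 s x
  have hQ : ∀ t, Continuous fun π : Wsp T n => Qcpl α (kolFlow m0 π) π t := by
    intro t
    unfold Qcpl
    fun_prop
  have hM : ∀ s, Continuous fun π : Wsp T n => kolFlow m0 π s := fun s => continuous_pi (hk s)
  have hb := fun π (hπ : InDelta π) => Jpot_terms_ne_bot α hconv (hnn π hπ) π
  unfold Jpot
  refine LowerSemicontinuousOn.ereal_add (LowerSemicontinuousOn.ereal_add
    (LowerSemicontinuousOn.ereal_sum _ (fun t _ => LowerSemicontinuousOn.ereal_sum _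
      (fun x _ => LowerSemicontinuousOn.ereal_coe_mul (hk _ x).continuousOn
        (LowerSemicontinuous.comp_continuousOn (hconv.1 t x).2.2.1 (by fun_prop))
        (fun π hπ => hnn π hπ _ _) fun π _ => (hconv.1 t x).1.2 _)
      fun x _ π hπ => EReal.coe_mul_ne_bot (hnn π hπ _ _) ((hconv.1 t x).1.2 _))
      fun t _ π hπ => (hb π hπ).1 t)
    (LowerSemicontinuousOn.ereal_sum _
      (fun t _ => (hconv.2.2 t).2.2.comp_continuousOn (hQ t).continuousOn)
      fun t _ π _ => (hconv.2.2 t).1.2 _)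
    (fun π hπ => (hb π hπ).2.1) fun π hπ => (hb π hπ).2.2.1)
    (LowerSemicontinuousOn.ereal_sum _
      (fun s _ => (hconv.2.1 s).2.2.comp_continuousOn (hM s).continuousOn)
      fun s _ π _ => (hconv.2.1 s).1.2 _)
    (fun π hπ => ?_) fun π hπ => (hb π hπ).2.2.2
  rw [Ne, EReal.add_eq_bot_iff, not_or]
  exact ⟨(hb π hπ).2.1, (hb π hπ).2.2.1⟩

theorem isCompact_setOf_inDelta : IsCompact {π : Wsp T n | InDelta π} := by
  have h : {π : Wsp T n | InDelta π} =
      Set.pi Set.univ fun _ => Set.pi Set.univ fun _ => simplex n := by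
    ext π
    simp [InDelta]
  rw [h]
  exact isCompact_univ_pi fun _ => isCompact_univ_pi fun _ => isCompact_simplex n

theorem exists_isSolP {ℓ : LSp T n} {F : FSp T n} {φ : PhiSp T} (α : ASp T n)
    (hconv : ConvAssumption ℓ F φ) {m0 : Fin n → ℝ} (hm0 : ∀ x, 0 ≤ m0 x) :
    ∃ p : Msp T n × Wsp T n, IsSolP ℓ F φ α m0 p := by
  have hne : ({π : Wsp T n | InDelta π}).Nonempty := by
    choose ρ hρ using fun t x => (hconv.1 t x).1.1
    exact ⟨ρ, fun t x => (hconv.1 t x).2.2.2 _ (hρ t x)⟩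
  obtain ⟨π, hπ, hmin⟩ := LowerSemicontinuousOn.exists_isMinOn hne isCompact_setOf_inDelta
    (lowerSemicontinuousOn_Jpot α hconv hm0)
  refine ⟨(kolFlow m0 π, π), ⟨hπ, isKol_kolFlow m0 π⟩, ?_⟩
  rintro ⟨m, q⟩ ⟨hq, hm⟩
  rw [show m = kolFlow m0 q from hm.eq_kolFlow]
  exact hmin hq

/-- The convex cone generated by the graph-like set `{(1, ρ, b) | h ρ ≤ b}`. -/
def perspCone (h : (Fin n → ℝ) → EReal) : Set (ℝ × (Fin n → ℝ) × ℝ) :=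
  {k | 0 ≤ k.1 ∧ ∃ (ρ : Fin n → ℝ) (b : ℝ), h ρ ≤ (b : EReal) ∧ k.2.1 = k.1 • ρ ∧ k.2.2 = k.1 * b}

theorem EConvexOn.convex_epigraph {E : Type*} [AddCommMonoid E] [Module ℝ E] {g : E → EReal}
    (hg : EConvexOn g) : Convex ℝ {p : E × ℝ | g p.1 ≤ (p.2 : EReal)} := by
  rintro ⟨x, r⟩ hx ⟨y, s⟩ hy a b ha hb hab
  simp only [Set.mem_ofPred_eq] at hx hy
  refine (hg x y a b ha hb hab).trans ?_
  have h1 := mul_le_mul_of_nonneg_left hx (EReal.coe_nonneg.2 ha)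
  have h2 := mul_le_mul_of_nonneg_left hy (EReal.coe_nonneg.2 hb)
  refine (add_le_add h1 h2).trans (le_of_eq ?_)
  rw [← EReal.coe_mul, ← EReal.coe_mul, ← EReal.coe_add]
  rfl

theorem convex_perspCone {h : (Fin n → ℝ) → EReal} (hh : EConvexOn h) :
    Convex ℝ (perspCone h) := by
  rintro ⟨θ₁, w₁, a₁⟩ ⟨h1, ρ₁, b₁, hb₁, hw₁, ha₁⟩ ⟨θ₂, w₂, a₂⟩ ⟨h2, ρ₂, b₂, hb₂, hw₂, ha₂⟩
    p q hp hq hpq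
  dsimp only at h1 h2 hw₁ hw₂ ha₁ ha₂
  subst hw₁ hw₂ ha₁ ha₂
  have hp1 := mul_nonneg hp h1
  have hq2 := mul_nonneg hq h2
  refine ⟨add_nonneg hp1 hq2, ?_⟩
  rcases eq_or_lt_of_le (add_nonneg hp1 hq2) with h0 | h0
  · have e1 : p * θ₁ = 0 := by linarith
    have e2 : q * θ₂ = 0 := by linarith
    refine ⟨ρ₁, b₁, hb₁, ?_, ?_⟩
    · simp [smul_smul, e1, e2]
    · simp [← mul_assoc, e1, e2]
  · set θ := p * θ₁ + q * θ₂ with hθ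
    have hsum : p * θ₁ / θ + q * θ₂ / θ = 1 := by
      rw [← add_div, ← hθ, div_self h0.ne']
    have hmem := hh.convex_epigraph (x := (ρ₁, b₁)) hb₁ (y := (ρ₂, b₂)) hb₂
      (a := p * θ₁ / θ) (b := q * θ₂ / θ) (by positivity) (by positivity) hsum
    refine ⟨_, _, hmem, ?_, ?_⟩
    · simp only [Prod.smul_mk, Prod.mk_add_mk, smul_eq_mul, smul_add, smul_smul, ← hθ]
      rw [mul_div_cancel₀ _ h0.ne', mul_div_cancel₀ _ h0.ne']
    · simp only [Prod.smul_mk, Prod.mk_add_mk, smul_eq_mul, ← hθ]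
      field_simp

/-- Variables of the convex program: `(m, w, a)` at each `(t, x)`, the terminal mass, and points of
the epigraphs of the congestion and price costs. -/
abbrev LiftSp (T n : ℕ) :=
  (Fin T → Fin n → ℝ × (Fin n → ℝ) × ℝ) × (Fin n → ℝ) ×
    (Fin (T + 1) → (Fin n → ℝ) × ℝ) × (Fin T → ℝ × ℝ)

def liftSet (ℓ : LSp T n) (F : FSp T n) (φ : PhiSp T) : Set (LiftSp T n) :=
  {c | (∀ t x, c.1 t x ∈ perspCone (ℓ t x)) ∧
    (∀ s, F s (c.2.2.1 s).1 ≤ ((c.2.2.1 s).2 : EReal)) ∧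
    ∀ t, φ t (c.2.2.2 t).1 ≤ ((c.2.2.2 t).2 : EReal)}

def liftMass (c : LiftSp T n) : Msp T n := Fin.snoc (fun t x => (c.1 t x).1) c.2.1

def liftGap (α : ASp T n) (m0 : Fin n → ℝ) (c : LiftSp T n) : Ksp T n :=
  (fun s x => (Fin.cases m0 (fun t x => ∑ y, (c.1 t y).2.1 x) s : Fin n → ℝ) x - liftMass c s x,
   fun s x => liftMass c s x - (c.2.2.1 s).1 x,
   fun t => (∑ x, ∑ y, (c.1 t x).2.1 y * α t x y) - (c.2.2.2 t).1)

def liftCost (c : LiftSp T n) : ℝ :=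
  (∑ t, ∑ x, (c.1 t x).2.2) + (∑ t, (c.2.2.2 t).2) + ∑ s, (c.2.2.1 s).2

@[simp]
theorem liftMass_castSucc (c : LiftSp T n) (t : Fin T) :
    liftMass c t.castSucc = fun x => (c.1 t x).1 := by
  simp [liftMass]

@[simp]
theorem liftMass_last (c : LiftSp T n) : liftMass c (Fin.last T) = c.2.1 := by
  simp [liftMass]

theorem liftMass_add_smul (c d : LiftSp T n) (a b : ℝ) :
    liftMass (a • c + b • d) = a • liftMass c + b • liftMass d := by
  funext s
  induction s using Fin.lastCases with
  | last => simp
  | cast t => ext; simp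

theorem liftGap_add_smul (α : ASp T n) (m0 : Fin n → ℝ) (c d : LiftSp T n) (a b : ℝ)
    (hab : a + b = 1) :
    liftGap α m0 (a • c + b • d) = a • liftGap α m0 c + b • liftGap α m0 d := by
  refine Prod.ext ?_ (Prod.ext ?_ ?_)
  · funext s x
    simp only [liftGap, liftMass_add_smul]
    induction s using Fin.cases with
    | zero =>
      simp
      linear_combination -(m0 x) * hab
    | succ t =>
      simp [Finset.sum_add_distrib, ← Finset.mul_sum]
      ring
  · funext s x
    simp only [liftGap, liftMass_add_smul]
    simp
    ring
  · funext t
    simp [liftGap, Finset.sum_add_distrib, ← Finset.mul_sum, add_mul, mul_assoc]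
    ring

theorem liftCost_add_smul (c d : LiftSp T n) (a b : ℝ) :
    liftCost (a • c + b • d) = a * liftCost c + b * liftCost d := by
  simp [liftCost, Finset.sum_add_distrib, ← Finset.mul_sum]
  ring

theorem convex_liftSet {ℓ : LSp T n} {F : FSp T n} {φ : PhiSp T}
    (hconv : ConvAssumption ℓ F φ) : Convex ℝ (liftSet ℓ F φ) := by
  rintro c ⟨h1, h2, h3⟩ d ⟨g1, g2, g3⟩ a b ha hb hab
  exact ⟨fun t x => convex_perspCone (hconv.1 t x).2.1 (h1 t x) (g1 t x) ha hb hab,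
    fun s => (hconv.2.1 s).2.1.convex_epigraph (h2 s) (g2 s) ha hb hab,
    fun t => (hconv.2.2 t).2.1.convex_epigraph (h3 t) (g3 t) ha hb hab⟩

theorem linearMap_Msp_eq_sum {A B : Type*} [Fintype A] [Fintype B]
    (k : (A → B → ℝ) →ₗ[ℝ] ℝ) :
    ∃ u : A → B → ℝ, ∀ η, k η = ∑ s, ∑ x, u s x * η s x := by
  refine ⟨fun s x => k (Pi.single s fun j => if x = j then 1 else 0), fun η => ?_⟩
  conv_lhs => rw [← Finset.univ_sum_single η]
  rw [map_sum]
  refine Finset.sum_congr rfl fun s _ => ?_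
  have h := (k.comp (LinearMap.single ℝ (fun _ : A => B → ℝ) s)).pi_apply_eq_sum_univ (η s)
  simpa [mul_comm] using h

theorem linearMap_Ksp_eq_kpair (k : Ksp T n →ₗ[ℝ] ℝ) : ∃ p : Ksp T n, ∀ q, k q = kpair p q := by
  obtain ⟨u, hu⟩ := linearMap_Msp_eq_sum (k.comp (LinearMap.inl ℝ (Msp T n) (Msp T n × Psp T)))
  obtain ⟨γ, hγ⟩ := linearMap_Msp_eq_sum
    (k.comp ((LinearMap.inr ℝ (Msp T n) (Msp T n × Psp T)).comp (LinearMap.inl ℝ _ _)))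
  have hP := (k.comp ((LinearMap.inr ℝ (Msp T n) (Msp T n × Psp T)).comp
    (LinearMap.inr ℝ _ _))).pi_apply_eq_sum_univ
  refine ⟨(u, γ, fun t => k (0, 0, fun j => if t = j then 1 else 0)), ?_⟩
  rintro ⟨q1, q2, q3⟩
  have h : ((q1, q2, q3) : Ksp T n) = (q1, 0, 0) + ((0, q2, 0) + (0, 0, q3)) := by simp
  have h1 := hu q1
  have h2 := hγ q2
  have h3 := hP q3
  simp only [LinearMap.comp_apply, LinearMap.inl_apply, LinearMap.inr_apply] at h1 h2 h3
  rw [h, map_add, map_add]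
  simp only [kpair]
  erw [h1, h2, h3]
  simp [mul_comm, add_assoc]

/-- The Lagrangian splits over `(t, x)`, `s` and `t`. -/
theorem liftCost_add_kpair_liftGap (α : ASp T n) (m0 : Fin n → ℝ) (c : LiftSp T n)
    (u γ : Msp T n) (P : Psp T) :
    liftCost c + kpair (u, γ, P) (liftGap α m0 c) =
      (∑ t, ∑ x, ((c.1 t x).2.2 + (c.1 t x).1 * (γ t.castSucc x - u t.castSucc x) +
        ∑ y, (c.1 t x).2.1 y * (α t x y * P t + u t.succ y))) +
      (∑ x, c.2.1 x * (γ (Fin.last T) x - u (Fin.last T) x)) +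
      (∑ s, ((c.2.2.1 s).2 - ∑ x, γ s x * (c.2.2.1 s).1 x)) +
      (∑ t, ((c.2.2.2 t).2 - P t * (c.2.2.2 t).1)) + ∑ x, u 0 x * m0 x := by
  have h1 : ∑ s, ∑ x, u s x * (liftGap α m0 c).1 s x =
      (∑ x, u 0 x * m0 x) + (∑ t, ∑ x, ∑ y, u t.succ y * (c.1 t x).2.1 y) -
      ((∑ t, ∑ x, u t.castSucc x * (c.1 t x).1) + ∑ x, u (Fin.last T) x * c.2.1 x) := by
    simp only [liftGap, mul_sub, Finset.sum_sub_distrib]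
    congr 1
    · rw [Fin.sum_univ_succ]
      simp only [Fin.cases_zero, Fin.cases_succ, Finset.mul_sum]
      congr 1
      exact Finset.sum_congr rfl fun t _ => Finset.sum_comm
    · rw [Fin.sum_univ_castSucc]
      simp
  have h2 : ∑ s, ∑ x, γ s x * (liftGap α m0 c).2.1 s x =
      (∑ t, ∑ x, γ t.castSucc x * (c.1 t x).1) + (∑ x, γ (Fin.last T) x * c.2.1 x) -
      ∑ s, ∑ x, γ s x * (c.2.2.1 s).1 x := by
    simp only [liftGap, mul_sub, Finset.sum_sub_distrib]
    congr 1
    rw [Fin.sum_univ_castSucc]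
    simp
  have h3 : ∑ t, P t * (liftGap α m0 c).2.2 t =
      (∑ t, ∑ x, ∑ y, (c.1 t x).2.1 y * (α t x y * P t)) - ∑ t, P t * (c.2.2.2 t).1 := by
    simp only [liftGap, mul_sub, Finset.sum_sub_distrib, Finset.mul_sum]
    congr 1
    exact Finset.sum_congr rfl fun t _ => Finset.sum_congr rfl fun x _ =>
      Finset.sum_congr rfl fun y _ => by ring
  simp only [kpair]
  rw [h1, h2, h3]
  simp only [liftCost, mul_add, mul_sub, Finset.sum_add_distrib, Finset.sum_sub_distrib]
  simp only [mul_comm]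
  ring

/-- The point of the convex program given by masses, a policy and the arguments of the costs. -/
def liftOf (ℓ : LSp T n) (F : FSp T n) (φ : PhiSp T) (m : Msp T n) (π : Wsp T n) (m' : Msp T n)
    (D : Psp T) : LiftSp T n :=
  (fun t x => (m t.castSucc x, m t.castSucc x • π t x,
      m t.castSucc x * (ℓ t x (π t x)).toReal),
   m (Fin.last T), fun s => (m' s, (F s (m' s)).toReal), fun t => (D t, (φ t (D t)).toReal))

theorem liftMass_liftOf (ℓ : LSp T n) (F : FSp T n) (φ : PhiSp T) (m : Msp T n) (π : Wsp T n)
    (m' : Msp T n) (D : Psp T) : liftMass (liftOf ℓ F φ m π m' D) = m := by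
  funext s
  induction s using Fin.lastCases with
  | last => simp [liftOf]
  | cast t => simp [liftOf]

theorem liftGap_liftOf (ℓ : LSp T n) (F : FSp T n) (φ : PhiSp T) (α : ASp T n)
    (m0 : Fin n → ℝ) (m : Msp T n) (π : Wsp T n) (m' : Msp T n) (D : Psp T) :
    liftGap α m0 (liftOf ℓ F φ m π m' D) =
      (fun s x => (Fin.cases m0 (fun t x => ∑ y, m t.castSucc y * π t y x) s : Fin n → ℝ) x - m s x,
       fun s x => m s x - m' s x, fun t => Qcpl α m π t - D t) := by
  unfold liftGap
  rw [liftMass_liftOf]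
  rfl

theorem liftOf_mem_liftSet {ℓ : LSp T n} {F : FSp T n} {φ : PhiSp T}
    (hconv : ConvAssumption ℓ F φ) {m : Msp T n} {π : Wsp T n} {m' : Msp T n} {D : Psp T}
    (hm : ∀ t x, 0 ≤ m t x) (hπ : ∀ (t : Fin T) x, 0 < m t.castSucc x → ℓ t x (π t x) ≠ ⊤)
    (hF : ∀ s, F s (m' s) ≠ ⊤) (hφ : ∀ t, φ t (D t) ≠ ⊤) :
    liftOf ℓ F φ m π m' D ∈ liftSet ℓ F φ := by
  refine ⟨fun t x => ⟨hm _ _, ?_⟩, fun s => EReal.le_coe_toReal (hF s),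
    fun t => EReal.le_coe_toReal (hφ t)⟩
  rcases eq_or_lt_of_le (hm t.castSucc x) with h | h
  · obtain ⟨ρ, hρ⟩ := (hconv.1 t x).1.1
    exact ⟨ρ, (ℓ t x ρ).toReal, EReal.le_coe_toReal hρ, by simp [liftOf, ← h]⟩
  · exact ⟨π t x, (ℓ t x (π t x)).toReal, EReal.le_coe_toReal (hπ t x h), rfl, rfl⟩

theorem Qualif.exists_liftGap_eq_smul {ℓ : LSp T n} {F : FSp T n} {φ : PhiSp T} {α : ASp T n}
    {m0 : Fin n → ℝ} (hq : Qualif ℓ F φ α m0) (hconv : ConvAssumption ℓ F φ) (e : Ksp T n) :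
    ∃ t : ℝ, 0 < t ∧ ∃ c ∈ liftSet ℓ F φ, liftGap α m0 c = t • e := by
  obtain ⟨α0, hα0, h⟩ := hq
  let ε1 : Msp T n := Fin.cases (-e.1 0) fun t => e.1 t.succ
  have hε0 : ε1 0 = -e.1 0 := rfl
  have hεs : ∀ t : Fin T, ε1 t.succ = e.1 t.succ := fun t => rfl
  let q := qnorm ε1 (-e.2.1) (-e.2.2)
  have hq0 : 0 ≤ q := Real.sqrt_nonneg _
  let r := α0 / (q + 1)
  have hr : 0 < r := by positivity
  have hnorm : qnorm (r • ε1) (r • -e.2.1) (r • -e.2.2) = r * q := by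
    simp only [q, qnorm, Pi.smul_apply, smul_eq_mul, mul_pow, ← Finset.mul_sum, ← mul_add]
    rw [Real.sqrt_mul (by positivity), Real.sqrt_sq hr.le]
  obtain ⟨π, hπ, m1, hm1, hm1', hF, hφ⟩ := h (r • ε1) (r • -e.2.1) (r • -e.2.2) (by
    rw [hnorm, div_mul_eq_mul_div, div_le_iff₀ (by positivity)]
    nlinarith)
  refine ⟨r, hr, _, liftOf_mem_liftSet hconv hm1' (fun t x _ => hπ t x) hF hφ, ?_⟩
  rw [liftGap_liftOf]
  refine Prod.ext ?_ (Prod.ext ?_ ?_)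
  · funext s x
    induction s using Fin.cases with
    | zero => simp [hm1.1, mbar0, hε0]
    | succ t => simp [hm1.2, hεs]
  · funext s x
    simp
  · funext t
    simp

theorem exists_feasP_Jpot_le_liftCost {ℓ : LSp T n} {F : FSp T n} {φ : PhiSp T} {α : ASp T n}
    {m0 : Fin n → ℝ} (hconv : ConvAssumption ℓ F φ) {c : LiftSp T n} (hc : c ∈ liftSet ℓ F φ)
    (h0 : liftGap α m0 c = 0) :
    ∃ p : Msp T n × Wsp T n, FeasP m0 p ∧ Jpot ℓ F φ α p.1 p.2 ≤ (liftCost c : EReal) := by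
  obtain ⟨hc1, hc2, hc3⟩ := hc
  choose hθ ρ b hb hw ha using hc1
  have h1 : ∀ s x, (liftGap α m0 c).1 s x = 0 := fun s x => by rw [h0]; rfl
  have h2 : ∀ s x, (liftGap α m0 c).2.1 s x = 0 := fun s x => by rw [h0]; rfl
  have h3 : ∀ t, (liftGap α m0 c).2.2 t = 0 := fun t => by rw [h0]; rfl
  refine ⟨(liftMass c, ρ), ⟨fun t x => (hconv.1 t x).2.2.2 _
    (ne_top_of_le_ne_top (EReal.coe_ne_top _) (hb t x)), ⟨fun x => ?_, fun t x => ?_⟩⟩, ?_⟩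
  · have := h1 0 x
    simp [liftGap] at this
    linarith
  · have := h1 t.succ x
    simp [liftGap, hw] at this
    simp
    linarith
  · have hm : ∀ s, liftMass c s = (c.2.2.1 s).1 := fun s => funext fun x => sub_eq_zero.1 (h2 s x)
    have hQ : ∀ t, Qcpl α (liftMass c) ρ t = (c.2.2.2 t).1 := by
      intro t
      rw [← sub_eq_zero, ← h3 t]
      simp [liftGap, Qcpl, hw]
    simp only [Jpot, liftCost, EReal.coe_add, EReal.coe_finset_sum, hQ]
    refine add_le_add (add_le_add (Finset.sum_le_sum fun t _ => Finset.sum_le_sum fun x _ => ?_)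
      (Finset.sum_le_sum fun t _ => hc3 t)) (Finset.sum_le_sum fun s _ => ?_)
    · rw [ha, EReal.coe_mul, liftMass_castSucc]
      exact mul_le_mul_of_nonneg_left (hb t x) (EReal.coe_nonneg.2 (hθ t x))
    · rw [hm]
      exact hc2 s

theorem Jpot_eq_liftCost {ℓ : LSp T n} {F : FSp T n} {φ : PhiSp T} (α : ASp T n)
    (hconv : ConvAssumption ℓ F φ) {m : Msp T n} {π : Wsp T n} (hm : ∀ s x, 0 ≤ m s x)
    (htop : Jpot ℓ F φ α m π ≠ ⊤) :
    (∀ (t : Fin T) x, 0 < m t.castSucc x → ℓ t x (π t x) ≠ ⊤) ∧ (∀ s, F s (m s) ≠ ⊤) ∧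
    (∀ t, φ t (Qcpl α m π t) ≠ ⊤) ∧
    Jpot ℓ F φ α m π = (liftCost (liftOf ℓ F φ m π m (Qcpl α m π)) : EReal) := by
  obtain ⟨b1, b2, b3, b4⟩ := Jpot_terms_ne_bot α hconv hm π
  have htop' := htop
  unfold Jpot at htop
  obtain ⟨h12, h3⟩ := EReal.ne_top_of_add_ne_top
    (by rw [Ne, EReal.add_eq_bot_iff, not_or]; exact ⟨b2, b3⟩) b4 htop
  obtain ⟨h1, h2⟩ := EReal.ne_top_of_add_ne_top b2 b3 h12
  have hF : ∀ s, F s (m s) ≠ ⊤ := fun s => EReal.ne_top_of_sum_ne_top _ _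
    (fun s _ => (hconv.2.1 s).1.2 _) h3 s (Finset.mem_univ s)
  have hφ : ∀ t, φ t (Qcpl α m π t) ≠ ⊤ := fun t => EReal.ne_top_of_sum_ne_top _ _
    (fun t _ => (hconv.2.2 t).1.2 _) h2 t (Finset.mem_univ t)
  have hℓ : ∀ (t : Fin T) x, 0 < m t.castSucc x → ℓ t x (π t x) ≠ ⊤ := by
    intro t x hpos hcon
    have h4 := EReal.ne_top_of_sum_ne_top _ _ (fun x _ => EReal.coe_mul_ne_bot (hm _ _)
      ((hconv.1 t x).1.2 _)) (EReal.ne_top_of_sum_ne_top _ _ (fun t _ => b1 t) h1 t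
        (Finset.mem_univ t)) x (Finset.mem_univ x)
    rw [hcon, EReal.coe_mul_top_of_pos hpos] at h4
    exact h4 rfl
  refine ⟨hℓ, hF, hφ, ?_⟩
  simp only [Jpot, liftCost, liftOf, EReal.coe_add, EReal.coe_finset_sum]
  congr 1
  · congr 1
    · refine Finset.sum_congr rfl fun t _ => Finset.sum_congr rfl fun x _ => ?_
      rcases eq_or_lt_of_le (hm t.castSucc x) with h | h
      · simp [← h]
      · rw [EReal.coe_mul, EReal.coe_toReal (hℓ t x h) ((hconv.1 t x).1.2 _)]
    · exact Finset.sum_congr rfl fun t _ =>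
        (EReal.coe_toReal (hφ t) ((hconv.2.2 t).1.2 _)).symm
  · exact Finset.sum_congr rfl fun s _ => (EReal.coe_toReal (hF s) ((hconv.2.1 s).1.2 _)).symm


theorem smul_mem_perspCone {h : (Fin n → ℝ) → EReal} {k : ℝ × (Fin n → ℝ) × ℝ}
    (hk : k ∈ perspCone h) {r : ℝ} (hr : 0 ≤ r) : r • k ∈ perspCone h := by
  obtain ⟨h0, ρ, b, hb, hw, ha⟩ := hk
  exact ⟨mul_nonneg hr h0, ρ, b, hb, by simp [hw, smul_smul], by simp [ha, mul_assoc]⟩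

/-- A solution of the potential problem satisfies the KKT conditions. -/
theorem exists_multipliers {ℓ : LSp T n} {F : FSp T n} {φ : PhiSp T} {α : ASp T n}
    {m0 : Fin n → ℝ} (hm0 : ∀ x, 0 ≤ m0 x) (hconv : ConvAssumption ℓ F φ)
    (hq : Qualif ℓ F φ α m0) :
    ∃ (m : Msp T n) (π : Wsp T n) (u γ : Msp T n) (P : Psp T),
      InDelta π ∧ IsKol m0 π m ∧ (∀ s x, 0 ≤ m s x) ∧
      (∀ t x ρ (b : ℝ), ℓ t x ρ ≤ (b : EReal) →
        u t.castSucc x ≤ b + γ t.castSucc x + ∑ y, ρ y * (α t x y * P t + u t.succ y)) ∧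
      (∀ (t : Fin T) x, 0 < m t.castSucc x → ℓ t x (π t x) ≠ ⊤ ∧
        u t.castSucc x = (ℓ t x (π t x)).toReal + γ t.castSucc x +
          ∑ y, π t x y * (α t x y * P t + u t.succ y)) ∧
      (∀ x, u (Fin.last T) x = γ (Fin.last T) x) ∧
      (∀ s, γ s ∈ subdiffFn (F s) (m s)) ∧ ∀ t, P t ∈ subdiffR (φ t) (Qcpl α m π t) := by
  obtain ⟨⟨m, π⟩, ⟨hπ, hkol⟩, hmin⟩ := exists_isSolP α hconv hm0
  dsimp only at hπ hkol hmin
  have hm : ∀ s x, 0 ≤ m s x := by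
    rw [hkol.eq_kolFlow]
    exact kolFlow_nonneg hm0 hπ
  have hle : ∀ c ∈ liftSet ℓ F φ, liftGap α m0 c = 0 →
      Jpot ℓ F φ α m π ≤ (liftCost c : EReal) := by
    intro c hc h0
    obtain ⟨p, hp, hp'⟩ := exists_feasP_Jpot_le_liftCost hconv hc h0
    exact (hmin p hp).trans hp'
  have htop : Jpot ℓ F φ α m π ≠ ⊤ := by
    obtain ⟨t, -, c, hc, h0⟩ := hq.exists_liftGap_eq_smul hconv 0
    exact ne_top_of_le_ne_top (EReal.coe_ne_top _) (hle c hc (by rw [h0, smul_zero]))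
  obtain ⟨hℓ, hF, hφ, hJ⟩ := Jpot_eq_liftCost α hconv hm htop
  set c₀ := liftOf ℓ F φ m π m (Qcpl α m π) with hc₀
  have hmem : c₀ ∈ liftSet ℓ F φ := liftOf_mem_liftSet hconv hm hℓ hF hφ
  have hgap : liftGap α m0 c₀ = 0 := by
    rw [hc₀, liftGap_liftOf]
    refine Prod.ext ?_ (Prod.ext ?_ ?_)
    · funext s x
      induction s using Fin.cases with
      | zero => simp [hkol.1]
      | succ t => simp [hkol.2]
    · funext s x
      simp
    · funext t
      simp
  obtain ⟨k, hk⟩ := exists_multiplier (convex_liftSet hconv) (liftGap α m0)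
    (fun c => liftCost c - liftCost c₀) (fun c d a b hab => liftGap_add_smul α m0 c d a b hab)
    (fun c d a b hab => by
      rw [liftCost_add_smul]
      linear_combination (liftCost c₀) * hab)
    (hq.exists_liftGap_eq_smul hconv)
    (fun c hc h0 => by
      have := hle c hc h0
      rw [hJ, EReal.coe_le_coe_iff] at this
      linarith)
  obtain ⟨⟨u, γ, P⟩, hp⟩ := linearMap_Ksp_eq_kpair k
  have hL : ∀ c ∈ liftSet ℓ F φ, liftCost c₀ + kpair (u, γ, P) (liftGap α m0 c₀) ≤
      liftCost c + kpair (u, γ, P) (liftGap α m0 c) := by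
    intro c hc
    have h1 := hk c hc
    rw [← hp, ← hp, hgap, map_zero]
    linarith
  simp only [liftCost_add_kpair_liftGap] at hL
  obtain ⟨hm1, hm2, hm3⟩ := hmem
  let H (t : Fin T) (x : Fin n) (k : ℝ × (Fin n → ℝ) × ℝ) : ℝ :=
    k.2.2 + k.1 * (γ t.castSucc x - u t.castSucc x) +
      ∑ y, k.2.1 y * (α t x y * P t + u t.succ y)
  have hH : ∀ t x, ∀ k ∈ perspCone (ℓ t x), H t x (c₀.1 t x) ≤ H t x k := by
    intro t x k hk
    refine le_of_sum_le_of_pi (fun i : Fin T × Fin n => perspCone (ℓ i.1 i.2))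
      (fun i => H i.1 i.2) (fun i => c₀.1 i.1 i.2) (fun i => hm1 i.1 i.2) ?_ (t, x) k hk
    intro y hy
    have := hL ((fun t x => y (t, x)), c₀.2) ⟨fun t x => hy (t, x), hm2, hm3⟩
    simp only [Fintype.sum_prod_type]
    linarith
  have hH0 : ∀ t x, H t x (c₀.1 t x) = 0 := by
    intro t x
    have h1 := hH t x _ (smul_mem_perspCone (hm1 t x) le_rfl)
    have h2 := hH t x _ (smul_mem_perspCone (hm1 t x) zero_le_two)
    have hs : ∀ r : ℝ, H t x (r • c₀.1 t x) = r * H t x (c₀.1 t x) := by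
      intro r
      simp [H, mul_add, Finset.mul_sum, mul_assoc]
    rw [hs] at h1 h2
    linarith
  have hterm : ∀ x, u (Fin.last T) x = γ (Fin.last T) x := by
    intro x
    have h1 := le_of_sum_le_of_pi (fun _ : Fin n => (Set.univ : Set ℝ))
      (fun x z => z * (γ (Fin.last T) x - u (Fin.last T) x)) (fun x => c₀.2.1 x)
      (fun _ => Set.mem_univ _) (by
        intro y _
        have := hL (c₀.1, y, c₀.2.2) ⟨hm1, hm2, hm3⟩
        linarith) x (c₀.2.1 x - (γ (Fin.last T) x - u (Fin.last T) x)) (Set.mem_univ _)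
    nlinarith [sq_nonneg (γ (Fin.last T) x - u (Fin.last T) x)]
  have hFs : ∀ s, ∀ q ∈ {q : (Fin n → ℝ) × ℝ | F s q.1 ≤ (q.2 : EReal)},
      (F s (m s)).toReal - ∑ x, γ s x * m s x ≤ q.2 - ∑ x, γ s x * q.1 x := by
    intro s q hq
    refine le_of_sum_le_of_pi (fun s => {q : (Fin n → ℝ) × ℝ | F s q.1 ≤ (q.2 : EReal)})
      (fun s q => q.2 - ∑ x, γ s x * q.1 x) (fun s => c₀.2.2.1 s) hm2 ?_ s q hq
    intro y hy
    have := hL (c₀.1, c₀.2.1, y, c₀.2.2.2) ⟨hm1, hy, hm3⟩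
    linarith
  have hφt : ∀ t, ∀ q ∈ {q : ℝ × ℝ | φ t q.1 ≤ (q.2 : EReal)},
      (φ t (Qcpl α m π t)).toReal - P t * Qcpl α m π t ≤ q.2 - P t * q.1 := by
    intro t q hq
    refine le_of_sum_le_of_pi (fun t => {q : ℝ × ℝ | φ t q.1 ≤ (q.2 : EReal)})
      (fun t q => q.2 - P t * q.1) (fun t => c₀.2.2.2 t) hm3 ?_ t q hq
    intro y hy
    have := hL (c₀.1, c₀.2.1, c₀.2.2.1, y) ⟨hm1, hm2, hy⟩
    linarith
  refine ⟨m, π, u, γ, P, hπ, hkol, hm, ?_, ?_, hterm, ?_, ?_⟩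
  · intro t x ρ b hb
    have h1 := hH t x (1, ρ, b) ⟨zero_le_one, ρ, b, hb, by simp, by simp⟩
    rw [hH0] at h1
    simp only [H, one_mul] at h1
    linarith
  · intro t x hpos
    refine ⟨hℓ t x hpos, ?_⟩
    have h1 := hH0 t x
    simp only [H, hc₀, liftOf, Pi.smul_apply, smul_eq_mul, mul_assoc, ← Finset.mul_sum,
      ← mul_add, mul_eq_zero, hpos.ne', false_or] at h1
    linarith
  · refine fun s => ⟨hF s, fun x' => ?_⟩
    by_cases hx : F s x' = ⊤
    · simp [hx]
    · have h1 := hFs s (x', (F s x').toReal) (EReal.le_coe_toReal hx)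
      rw [← EReal.coe_toReal (hF s) ((hconv.2.1 s).1.2 _),
        ← EReal.coe_toReal hx ((hconv.2.1 s).1.2 _), ← EReal.coe_add, EReal.coe_le_coe_iff]
      simp only [mul_sub, Finset.sum_sub_distrib]
      dsimp only at h1
      linarith
  · refine fun t => ⟨hφ t, fun x' => ?_⟩
    by_cases hx : φ t x' = ⊤
    · simp [hx]
    · have h1 := hφt t (x', (φ t x').toReal) (EReal.le_coe_toReal hx)
      rw [← EReal.coe_toReal (hφ t) ((hconv.2.2 t).1.2 _),
        ← EReal.coe_toReal hx ((hconv.2.2 t).1.2 _), ← EReal.coe_add, EReal.coe_le_coe_iff]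
      linarith

theorem exists_forall_toReal_add_sum_le {h : (Fin n → ℝ) → EReal} (hp : EProper h)
    (hlsc : LowerSemicontinuous h) (hdom : ∀ ρ, h ρ ≠ ⊤ → ρ ∈ simplex n) (v : Fin n → ℝ) :
    ∃ ρ, h ρ ≠ ⊤ ∧ ∀ (ρ' : Fin n → ℝ) (b : ℝ), h ρ' ≤ (b : EReal) →
      (h ρ).toReal + ∑ y, ρ y * v y ≤ b + ∑ y, ρ' y * v y := by
  obtain ⟨ρ₁, hρ₁⟩ := hp.1
  have hc : LowerSemicontinuous fun ρ : Fin n → ℝ => ((∑ y, ρ y * v y : ℝ) : EReal) :=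
    Continuous.lowerSemicontinuous (continuous_coe_real_ereal.comp (by fun_prop))
  obtain ⟨ρ, hρ, hmin⟩ := LowerSemicontinuousOn.exists_isMinOn ⟨ρ₁, hdom ρ₁ hρ₁⟩
    (isCompact_simplex n) ((hlsc.lowerSemicontinuousOn _).ereal_add (hc.lowerSemicontinuousOn _)
      (fun ρ _ => hp.2 ρ) fun _ _ => EReal.coe_ne_bot _)
  have hle : ∀ (ρ' : Fin n → ℝ) (b : ℝ), h ρ' ≤ (b : EReal) →
      h ρ + ((∑ y, ρ y * v y : ℝ) : EReal) ≤ ((b + ∑ y, ρ' y * v y : ℝ) : EReal) := by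
    intro ρ' b hb
    refine (hmin (hdom ρ' (ne_top_of_le_ne_top (EReal.coe_ne_top _) hb))).trans ?_
    rw [EReal.coe_add]
    exact add_le_add hb le_rfl
  have hfin : h ρ ≠ ⊤ := (EReal.ne_top_of_add_ne_top (hp.2 ρ) (EReal.coe_ne_bot _)
    (ne_top_of_le_ne_top (EReal.coe_ne_top _) (hle ρ₁ _ (EReal.le_coe_toReal hρ₁)))).1
  refine ⟨ρ, hfin, fun ρ' b hb => ?_⟩
  have h1 := hle ρ' b hb
  rwa [← EReal.coe_toReal hfin (hp.2 ρ), ← EReal.coe_add, EReal.coe_le_coe_iff] at h1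

theorem exists_valueFunction {ℓ : LSp T n} {F : FSp T n} {φ : PhiSp T}
    (hconv : ConvAssumption ℓ F φ) (α : ASp T n) (γ : Msp T n) (P : Psp T) :
    ∃ (U : Msp T n) (r : Wsp T n), (∀ x, U (Fin.last T) x = γ (Fin.last T) x) ∧
      (∀ t x, ℓ t x (r t x) ≠ ⊤ ∧ U t.castSucc x = (ℓ t x (r t x)).toReal + γ t.castSucc x +
        ∑ y, r t x y * (α t x y * P t + U t.succ y)) ∧
      ∀ t x ρ (b : ℝ), ℓ t x ρ ≤ (b : EReal) →
        U t.castSucc x ≤ b + γ t.castSucc x + ∑ y, ρ y * (α t x y * P t + U t.succ y) := by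
  choose r hr hr' using fun t x v => exists_forall_toReal_add_sum_le (hconv.1 t x).1
    (hconv.1 t x).2.2.1 (hconv.1 t x).2.2.2 v
  let q (t : Fin T) (v : Fin n → ℝ) (x y : Fin n) : ℝ := α t x y * P t + v y
  let U : Msp T n := Fin.reverseInduction (γ (Fin.last T)) fun t v x =>
    (ℓ t x (r t x (q t v x))).toReal + γ t.castSucc x +
      ∑ y, r t x (q t v x) y * (α t x y * P t + v y)
  have hU : ∀ t x, U t.castSucc x = (ℓ t x (r t x (q t (U t.succ) x))).toReal + γ t.castSucc x +
      ∑ y, r t x (q t (U t.succ) x) y * (α t x y * P t + U t.succ y) := by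
    intro t x
    simp only [U, Fin.reverseInduction_castSucc]
  refine ⟨U, fun t x => r t x (q t (U t.succ) x), fun x => ?_, fun t x => ⟨hr _ _ _, hU t x⟩, ?_⟩
  · simp only [U, Fin.reverseInduction_last]
  · intro t x ρ b hb
    have := hr' t x (q t (U t.succ) x) ρ b hb
    rw [hU]
    simp only [q] at this ⊢
    linarith

theorem iInf_simplex_eq_coe {h : (Fin n → ℝ) → EReal} (hp : EProper h)
    (hdom : ∀ ρ, h ρ ≠ ⊤ → ρ ∈ simplex n) (c : ℝ) (v ρ : Fin n → ℝ) (a : ℝ)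
    (hρ : h ρ ≠ ⊤) (ha : a = (h ρ).toReal + c + ∑ y, ρ y * v y)
    (hle : ∀ (ρ' : Fin n → ℝ) (b : ℝ), h ρ' ≤ (b : EReal) → a ≤ b + c + ∑ y, ρ' y * v y) :
    (a : EReal) = ⨅ ρ ∈ simplex n, h ρ + ↑c + ↑(∑ y, ρ y * v y) := by
  refine le_antisymm (le_iInf₂ fun ρ' _ => ?_) ((iInf₂_le ρ (hdom ρ hρ)).trans ?_)
  · by_cases ht : h ρ' = ⊤
    · simp [ht]
    · have := hle ρ' _ (EReal.le_coe_toReal ht)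
      rw [← EReal.coe_toReal ht (hp.2 _)]
      exact_mod_cast this
  · rw [ha, EReal.coe_add, EReal.coe_add, EReal.coe_toReal hρ (hp.2 _)]

/-- Corollary 1: under the convexity and qualification
assumptions, the MFG system admits a solution. -/
theorem mfg_existence {T n : ℕ} (hT : 1 ≤ T) (hn : 1 ≤ n)
    (ℓ : LSp T n) (F : FSp T n) (φ : PhiSp T) (α : ASp T n)
    (m0 : Fin n → ℝ) (hm0 : m0 ∈ simplex n)
    (hconv : ConvAssumption ℓ F φ) (hqual : Qualif ℓ F φ α m0) :
    ∃ (m : Msp T n) (π : Wsp T n) (u γ : Msp T n) (P : Psp T),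
      IsMFGSol ℓ F φ α m0 m π u γ P := by
  obtain ⟨m, π, u, γ, P, hπ, hkol, hm, hu, hu', hT', hγ, hP⟩ :=
    exists_multipliers (fun x => (hm0.1 x).1) hconv hqual
  obtain ⟨U, r, hUT, hU, hUle⟩ := exists_valueFunction hconv α γ P
  have huU : ∀ s x, u s x ≤ U s x := by
    intro s
    induction s using Fin.reverseInduction with
    | last => exact fun x => by rw [hUT, hT']
    | cast t ih =>
      intro x
      refine (hu t x _ _ (EReal.le_coe_toReal (hU t x).1)).trans ?_
      rw [(hU t x).2]
      gcongr with y _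
      · exact (((hconv.1 t x).2.2.2 _ (hU t x).1).1 y).1
      · exact ih y
  have hpos : ∀ t x y, 0 < m (Fin.castSucc t) x → 0 < π t x y → 0 < m t.succ y := by
    intro t x y h1 h2
    rw [hkol.2]
    exact Finset.sum_pos' (fun z _ => mul_nonneg (hm _ z) ((hπ t z).1 y).1)
      ⟨x, Finset.mem_univ x, mul_pos h1 h2⟩
  have hUπ : ∀ s x, 0 < m s x → U s x = u s x := by
    intro s
    induction s using Fin.reverseInduction with
    | last => exact fun x _ => by rw [hUT, hT']
    | cast t ih =>
      intro x hx
      refine le_antisymm ?_ (huU _ x)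
      refine (hUle t x _ _ (EReal.le_coe_toReal (hu' t x hx).1)).trans ?_
      rw [(hu' t x hx).2]
      refine add_le_add le_rfl (Finset.sum_le_sum fun y _ => ?_)
      rcases eq_or_lt_of_le ((hπ t x).1 y).1 with h | h
      · simp [← h]
      · rw [ih y (hpos t x y hx h)]
  have hUπ' : ∀ t x, 0 < m (Fin.castSucc t) x → U t.castSucc x =
      (ℓ t x (π t x)).toReal + γ t.castSucc x +
        ∑ y, π t x y * (α t x y * P t + U t.succ y) := by
    intro t x hx
    rw [hUπ _ x hx, (hu' t x hx).2]
    congr 1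
    refine Finset.sum_congr rfl fun y _ => ?_
    rcases eq_or_lt_of_le ((hπ t x).1 y).1 with h | h
    · simp [← h]
    · rw [hUπ _ y (hpos t x y hx h)]
  let π' : Wsp T n := fun t x => if 0 < m t.castSucc x then π t x else r t x
  have hmul : ∀ t x y, m (Fin.castSucc t) x * π' t x y = m t.castSucc x * π t x y := by
    intro t x y
    by_cases h : 0 < m t.castSucc x
    · simp [π', h]
    · simp [le_antisymm (not_lt.1 h) (hm _ _)]
  have hπ' : ∀ t x, ℓ t x (π' t x) ≠ ⊤ ∧ U t.castSucc x =
      (ℓ t x (π' t x)).toReal + γ t.castSucc x +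
        ∑ y, π' t x y * (α t x y * P t + U t.succ y) := by
    intro t x
    by_cases h : 0 < m t.castSucc x
    · simp only [π', if_pos h]
      exact ⟨(hu' t x h).1, hUπ' t x h⟩
    · simp only [π', if_neg h]
      exact hU t x
  refine ⟨m, π', U, γ, P, fun t x => (hconv.1 t x).2.2.2 _ (hπ' t x).1,
    ⟨fun t x => iInf_simplex_eq_coe (hconv.1 t x).1 (hconv.1 t x).2.2.2 _ _ _ _ (hπ' t x).1
      (hπ' t x).2 (hUle t x), hUT⟩, fun t x => ?_,
    ⟨hkol.1, fun t x => by simp only [hmul]; exact hkol.2 t x⟩, hγ, fun t => ?_⟩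
  · rw [(hπ' t x).2, EReal.coe_add, EReal.coe_add, EReal.coe_toReal (hπ' t x).1
      ((hconv.1 t x).1.2 _)]
  · have hQ : Qcpl α m π' t = Qcpl α m π t := by simp only [Qcpl, hmul]
    rw [hQ]
    exact hP t

end
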